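/- Let b_m(α) := y_m(α) − (1/(m+1))(1 − 1/m) y_m(α)^2. Then for every α ⊆ {2,3,4,…} and every integer m ≥ 2: |b_{m+1}(α) − b_m(α)| ≤ y_m(α)/m if m ∈ α, and |b_{m+1}(α) − b_m(α)| ≤ y_m(α)^2/(m(m+1)) if m ∉ α. -/

import Mathlib

open MeasureTheory Filter Finset Asymptotics
open scoped Classical

/-- `y_m(α) = ∏_{j ∈ α, j < m} (1 - 1/j)` (empty product = 1). -/
noncomputable def hawkinsY (A : Set ℕ) (m : ℕ) : ℝ :=
  ∏ j ∈ Finset.range m, if j ∈ A then 1 - 1 / (j : ℝ) else 1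

/-- The σ-algebra generated by the events `{j ∈ α}` for `2 ≤ j < m`. -/
def sieveSigma {Ω : Type*} (α : Ω → Set ℕ) (m : ℕ) : MeasurableSpace Ω :=
  MeasurableSpace.generateFrom {s | ∃ j : ℕ, 2 ≤ j ∧ j < m ∧ s = {ω | j ∈ α ω}}

/-- Wunderlich's model of the Hawkins random sieve: a probability space `(Ω, μ)` with a
random subset `α` of `{2,3,4,…}` such that `μ(2 ∈ α) = 1` and, for every `m ≥ 2`, the
conditional probability of `{m ∈ α}` given the σ-algebra generated by the events
`{j ∈ α}`, `2 ≤ j < m`, equals `y_m(α)`. -/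
structure IsHawkinsSieve {Ω : Type*} [MeasurableSpace Ω] (μ : Measure Ω)
    (α : Ω → Set ℕ) : Prop where
  isProb : IsProbabilityMeasure μ
  meas : ∀ n : ℕ, MeasurableSet {ω | n ∈ α ω}
  mem_ge_two : ∀ ω, ∀ n ∈ α ω, 2 ≤ n
  two_mem : μ {ω | 2 ∈ α ω} = 1
  condExp_mem : ∀ m : ℕ, 2 ≤ m →
    μ[Set.indicator {ω | m ∈ α ω} (fun _ => (1 : ℝ)) | sieveSigma α m]
      =ᵐ[μ] fun ω => hawkinsY (α ω) m

/-- `M_k = 1 + ∑_{j=1}^{k-2} 1/j` (so `M_2 = 1`). -/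
noncomputable def Mharm (k : ℕ) : ℝ := 1 + ∑ j ∈ Finset.Icc 1 (k - 2), 1 / (j : ℝ)

/-- `b_m(α) = y_m(α) - (1/(m+1))(1 - 1/m) y_m(α)^2`. -/
noncomputable def bAux (A : Set ℕ) (m : ℕ) : ℝ :=
  hawkinsY A m - (1 / ((m : ℝ) + 1)) * (1 - 1 / (m : ℝ)) * (hawkinsY A m) ^ 2

theorem hawkinsY_succ (A : Set ℕ) (m : ℕ) :
    hawkinsY A (m + 1) = hawkinsY A m * if m ∈ A then 1 - 1 / (m : ℝ) else 1 :=
  Finset.prod_range_succ _ m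

theorem one_sub_one_div_natCast_mem_Icc (j : ℕ) : 1 - 1 / (j : ℝ) ∈ Set.Icc (0 : ℝ) 1 := by
  have h : 1 / (j : ℝ) ≤ 1 := by simpa using Nat.cast_inv_le_one (α := ℝ) j
  have h' : 0 ≤ 1 / (j : ℝ) := by positivity
  exact ⟨by linarith, by linarith⟩

theorem hawkinsY_nonneg (A : Set ℕ) (m : ℕ) : 0 ≤ hawkinsY A m := by
  refine Finset.prod_nonneg fun j _ => ?_
  split_ifs
  exacts [(one_sub_one_div_natCast_mem_Icc j).1, zero_le_one]

theorem hawkinsY_le_one (A : Set ℕ) (m : ℕ) : hawkinsY A m ≤ 1 := by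
  refine Finset.prod_le_one (fun j _ => ?_) fun j _ => ?_ <;> split_ifs
  exacts [(one_sub_one_div_natCast_mem_Icc j).1, zero_le_one,
    (one_sub_one_div_natCast_mem_Icc j).2, le_rfl]

theorem bAux_succ_sub_of_mem {A : Set ℕ} {m : ℕ} (hm : m ≠ 0) (h : m ∈ A) :
    bAux A (m + 1) - bAux A m = -(hawkinsY A m / m) +
      3 * (hawkinsY A m) ^ 2 * (m - 1) / (m * (m + 1) * (m + 2)) := by
  have h0 : (m : ℝ) ≠ 0 := Nat.cast_ne_zero.2 hm
  have h1 : (m : ℝ) + 1 ≠ 0 := by positivity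
  have h2 : (m : ℝ) + 2 ≠ 0 := by positivity
  have h2' : (m : ℝ) + 1 + 1 ≠ 0 := by positivity
  simp only [bAux, hawkinsY_succ, if_pos h]
  push_cast
  field_simp
  ring

theorem bAux_succ_sub_of_notMem {A : Set ℕ} {m : ℕ} (hm : m ≠ 0) (h : m ∉ A) :
    bAux A (m + 1) - bAux A m =
      (hawkinsY A m) ^ 2 / (m * (m + 1)) * ((m - 2) / (m + 2)) := by
  have h0 : (m : ℝ) ≠ 0 := Nat.cast_ne_zero.2 hm
  have h1 : (m : ℝ) + 1 ≠ 0 := by positivity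
  have h2 : (m : ℝ) + 2 ≠ 0 := by positivity
  have h2' : (m : ℝ) + 1 + 1 ≠ 0 := by positivity
  simp only [bAux, hawkinsY_succ, if_neg h]
  push_cast
  field_simp
  ring

theorem bAux_difference_bound (A : Set ℕ) (hA : ∀ n ∈ A, 2 ≤ n) (m : ℕ) (hm : 2 ≤ m) :
    (m ∈ A → |bAux A (m + 1) - bAux A m| ≤ hawkinsY A m / m) ∧
    (m ∉ A → |bAux A (m + 1) - bAux A m| ≤ (hawkinsY A m) ^ 2 / (m * (m + 1))) := by
  have hm0 : m ≠ 0 := by omega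
  have hm2 : (2 : ℝ) ≤ m := by exact_mod_cast hm
  have hpos : (0 : ℝ) < m := by linarith
  have hy0 := hawkinsY_nonneg A m
  have hy1 := hawkinsY_le_one A m
  refine ⟨fun h => ?_, fun h => ?_⟩
  · rw [bAux_succ_sub_of_mem hm0 h]
    set y := hawkinsY A m
    have hnonneg : 0 ≤ 3 * y ^ 2 * ((m : ℝ) - 1) / (m * (m + 1) * (m + 2)) :=
      div_nonneg (mul_nonneg (by positivity) (by linarith)) (by positivity)
    have hle : 3 * y ^ 2 * ((m : ℝ) - 1) / (m * (m + 1) * (m + 2)) ≤ 2 * (y / m) := by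
      have hcoef : 3 * y * ((m : ℝ) - 1) ≤ 2 * ((m + 1) * (m + 2)) := by nlinarith
      calc 3 * y ^ 2 * ((m : ℝ) - 1) / (m * (m + 1) * (m + 2))
          = y * (3 * y * ((m : ℝ) - 1)) / (m * (m + 1) * (m + 2)) := by ring
        _ ≤ y * (2 * ((m + 1) * (m + 2))) / (m * (m + 1) * (m + 2)) := by gcongr
        _ = 2 * (y / m) := by field_simp
    rw [abs_le]
    constructor <;> linarith
  · rw [bAux_succ_sub_of_notMem hm0 h,
      abs_of_nonneg (mul_nonneg (by positivity) (div_nonneg (by linarith) (by positivity)))]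
    refine mul_le_of_le_one_right (by positivity) ?_
    rw [div_le_one (by positivity)]
    linarith
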